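/- Theorem 1.1(f). Fix a real number x > 1/2 and suppose k = k(n) = n^{1 + x + o(1)}, i.e. ln k(n) / ln n → 1 + x as n → ∞. Then asymptotically almost surely ξ(K_n, k) = 2. -/

import Mathlib

open Finset Filter

/-- Positions: `p t a` is the vertex (an element of `Fin n`) occupied by agent `a` at the end of
round `t`. `greenSet n k p t` is the set of green agents at the end of round `t`; the initially
green agent is the agent with index `0`, and a white agent becomes green as soon as it occupies
the same vertex as a green agent. -/
def greenSet (n k : ℕ) (p : ℕ → Fin k → Fin n) : ℕ → Finset (Fin k)
  | 0 => Finset.univ.filter fun a => ∃ b : Fin k, (b : ℕ) = 0 ∧ p 0 a = p 0 b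
  | t + 1 =>
      greenSet n k p t ∪
        Finset.univ.filter fun a => ∃ b ∈ greenSet n k p t, p (t + 1) a = p (t + 1) b

/-- The probability that the `k` agents follow the trajectory prefix `p` during rounds
`0, 1, …, T`: each agent starts at a uniformly random vertex of `K_n` and then moves, each round
and independently of everything else, to a uniformly random vertex distinct from its current
one. -/
noncomputable def prefixProb (n k T : ℕ) (p : Fin (T + 1) → Fin k → Fin n) : ℝ :=
  ∏ a : Fin k, ((n : ℝ)⁻¹ *
    ∏ t : Fin T, if p t.succ a = p t.castSucc a then 0 else ((n : ℝ) - 1)⁻¹)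

/-- `probXiLe n k T` is `P(ξ(K_n, k) ≤ T)`: the probability that the broadcast is complete by
the end of round `T`. -/
noncomputable def probXiLe (n k T : ℕ) : ℝ :=
  ∑ p : Fin (T + 1) → Fin k → Fin n,
    if greenSet n k (fun t a => p ⟨min t T, Nat.lt_succ_of_le (min_le_right t T)⟩ a) T
        = Finset.univ
      then prefixProb n k T p else 0

/-- `probXiEq n k t` is `P(ξ(K_n, k) = t)`. -/
noncomputable def probXiEq (n k : ℕ) : ℕ → ℝ
  | 0 => probXiLe n k 0
  | t + 1 => probXiLe n k (t + 1) - probXiLe n k t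

/-- `probXiMem n k S` is `P(ξ(K_n, k) ∈ S)`: the probability that the broadcasting time of the
process with `k` agents on `K_n` belongs to the set `S ⊆ ℕ`. -/
noncomputable def probXiMem (n k : ℕ) (S : Set ℕ) : ℝ :=
  ∑' t, S.indicator (probXiEq n k) t

/-- `expXi n k = E[ξ(K_n, k)] = ∑_{t ≥ 0} P(ξ(K_n, k) > t)`. -/
noncomputable def expXi (n k : ℕ) : ℝ :=
  ∑' t, (1 - probXiLe n k t)

section ProductMass

variable {ι Y : Type*} [Fintype ι] [DecidableEq ι] [Fintype Y]

open Classical in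
/-- The mass that the product of `ι` copies of the weight `w` gives to the event `E`. -/
noncomputable def productMass (w : Y → ℝ) (E : (ι → Y) → Prop) : ℝ :=
  ∑ q : ι → Y, if E q then ∏ i, w (q i) else 0

theorem productMass_nonneg {w : Y → ℝ} (hw : ∀ y, 0 ≤ w y) (E : (ι → Y) → Prop) :
    0 ≤ productMass w E :=
  sum_nonneg fun q _ => by
    split_ifs
    exacts [prod_nonneg fun i _ => hw _, le_rfl]

theorem sum_prod_eq_one {w : Y → ℝ} (h1 : ∑ y, w y = 1) :
    ∑ q : ι → Y, ∏ i, w (q i) = 1 := by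
  classical
  have := Finset.prod_univ_sum (t := fun _ : ι => (univ : Finset Y)) (f := fun _ y => w y)
  simpa [Fintype.piFinset_univ, h1] using this.symm

theorem productMass_add_not {w : Y → ℝ} (h1 : ∑ y, w y = 1) (E : (ι → Y) → Prop) :
    productMass w E + productMass w (fun q => ¬ E q) = 1 := by
  rw [productMass, productMass, ← sum_add_distrib, ← sum_prod_eq_one (ι := ι) h1]
  refine sum_congr rfl fun q _ => ?_
  by_cases h : E q <;> simp [h]

theorem productMass_mono {w : Y → ℝ} (hw : ∀ y, 0 ≤ w y) {D E : (ι → Y) → Prop}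
    (h : ∀ q, (∀ i, w (q i) ≠ 0) → D q → E q) : productMass w D ≤ productMass w E := by
  refine sum_le_sum fun q _ => ?_
  have hq : 0 ≤ ∏ i, w (q i) := prod_nonneg fun i _ => hw _
  by_cases h0 : ∀ i, w (q i) ≠ 0
  · have := h q h0
    split_ifs <;> simp_all
  · rw [prod_eq_zero_iff.2 (by simpa using h0)]
    simp

/-- Union bound: the probability that, for some `j ∈ J`, none of the independent coordinates is
good for `j`. -/
theorem productMass_exists_forall_not_le {κ : Type*} {w : Y → ℝ} (hw : ∀ y, 0 ≤ w y)
    (h1 : ∑ y, w y = 1) (J : Finset κ) (good : κ → Y → Prop) [∀ j, DecidablePred (good j)]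
    (δ : ℝ) (hδ : ∀ j ∈ J, δ ≤ ∑ y, if good j y then w y else 0) :
    productMass (ι := ι) w (fun q => ∃ j ∈ J, ∀ i, ¬ good j (q i)) ≤
      J.card * Real.exp (-(δ * Fintype.card ι)) := by
  classical
  have key : ∀ j ∈ J, ∑ q : ι → Y, ∏ i, (if good j (q i) then 0 else w (q i)) ≤
      Real.exp (-(δ * Fintype.card ι)) := by
    intro j hj
    have e : ∑ q : ι → Y, ∏ i, (if good j (q i) then 0 else w (q i)) =
        (∑ y, if good j y then 0 else w y) ^ Fintype.card ι := by
      have := Finset.prod_univ_sum (t := fun _ : ι => (univ : Finset Y))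
        (f := fun _ y => if good j y then 0 else w y)
      simp only [Fintype.piFinset_univ] at this
      rw [← this]
      simp
    have e2 : (∑ y, if good j y then 0 else w y) ≤ 1 - δ := by
      have : (∑ y, if good j y then 0 else w y) + (∑ y, if good j y then w y else 0) = 1 := by
        rw [← sum_add_distrib, ← h1]
        refine sum_congr rfl fun y _ => ?_
        split_ifs <;> simp
      linarith [hδ j hj]
    rw [e]
    calc _ ≤ (Real.exp (-δ)) ^ Fintype.card ι := by
          refine pow_le_pow_left₀ (sum_nonneg fun y _ => ?_)
            (e2.trans (by linarith [Real.add_one_le_exp (-δ)])) _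
          split_ifs
          exacts [le_rfl, hw y]
      _ = _ := by rw [← Real.exp_nat_mul]; ring_nf
  calc productMass (ι := ι) w (fun q => ∃ j ∈ J, ∀ i, ¬ good j (q i))
      ≤ ∑ q : ι → Y, ∑ j ∈ J, ∏ i, (if good j (q i) then 0 else w (q i)) := by
        refine sum_le_sum fun q _ => ?_
        have hn : ∀ j ∈ J, 0 ≤ ∏ i, (if good j (q i) then 0 else w (q i)) := fun j _ =>
          prod_nonneg fun i _ => by
            split_ifs
            exacts [le_rfl, hw _]
        split_ifs with h
        · obtain ⟨j, hj, hji⟩ := h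
          refine le_trans (le_of_eq ?_) (single_le_sum hn hj)
          exact prod_congr rfl fun i _ => by simp [hji i]
        · exact sum_nonneg hn
    _ = ∑ j ∈ J, ∑ q : ι → Y, ∏ i, (if good j (q i) then 0 else w (q i)) := sum_comm
    _ ≤ J.card * Real.exp (-(δ * Fintype.card ι)) := by
        rw [← nsmul_eq_mul]
        exact sum_le_card_nsmul _ _ _ key

/-- Splitting the coordinates into two independent groups and conditioning on the first one. -/
theorem productMass_le_add {w : Y → ℝ} (hw : ∀ y, 0 ≤ w y) (h1 : ∑ y, w y = 1)
    (P : ι → Prop) [DecidablePred P] (D : (ι → Y) → Prop) (E : ({i // P i} → Y) → Prop)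
    (F : ({i // P i} → Y) → ({i // ¬ P i} → Y) → Prop) {ε₁ ε₂ : ℝ}
    (hE : productMass w E ≤ ε₁) (hF : ∀ α, productMass w (F α) ≤ ε₂)
    (hD : ∀ q, D q → E (fun i => q i) ∨ F (fun i => q i) (fun i => q i)) :
    productMass w D ≤ ε₁ + ε₂ := by
  classical
  have step : productMass w D ≤ ∑ αβ : ({i // P i} → Y) × ({i // ¬ P i} → Y),
      ((if E αβ.1 then ∏ i, w (αβ.1 i) else 0) * ∏ i, w (αβ.2 i) +
        (∏ i, w (αβ.1 i)) * (if F αβ.1 αβ.2 then ∏ i, w (αβ.2 i) else 0)) := by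
    rw [← (Equiv.piEquivPiSubtypeProd P (fun _ => Y)).sum_comp]
    refine sum_le_sum fun q _ => ?_
    rw [← Fintype.prod_subtype_mul_prod_subtype P (fun i => w (q i))]
    have a1 : 0 ≤ ∏ i : {i // P i}, w (q i) := prod_nonneg fun i _ => hw _
    have a2 : 0 ≤ ∏ i : {i // ¬ P i}, w (q i) := prod_nonneg fun i _ => hw _
    have a3 := mul_nonneg a1 a2
    simp only [Equiv.piEquivPiSubtypeProd_apply]
    have := hD q
    split_ifs <;> simp_all
  refine step.trans ?_
  rw [sum_add_distrib, Fintype.sum_prod_type, Fintype.sum_prod_type]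
  simp only [← mul_sum]
  rw [← sum_mul, sum_prod_eq_one h1, mul_one]
  refine add_le_add hE ?_
  calc _ ≤ ∑ α : {i // P i} → Y, (∏ i, w (α i)) * ε₂ :=
        sum_le_sum fun α _ => mul_le_mul_of_nonneg_left (hF α) (prod_nonneg fun i _ => hw _)
    _ = ε₂ := by rw [← sum_mul, sum_prod_eq_one h1, one_mul]

end ProductMass


/-- The probability that an agent at `a` moves to `b`. -/
noncomputable def moveWeight (n : ℕ) (a b : Fin n) : ℝ :=
  if b = a then 0 else ((n : ℝ) - 1)⁻¹

theorem moveWeight_nonneg {n : ℕ} (hn : 2 ≤ n) (a b : Fin n) : 0 ≤ moveWeight n a b := by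
  have : (2 : ℝ) ≤ n := by exact_mod_cast hn
  rw [moveWeight]
  split_ifs
  exacts [le_rfl, inv_nonneg.2 (by linarith)]

theorem moveWeight_le {n : ℕ} (hn : 2 ≤ n) (a b : Fin n) :
    moveWeight n a b ≤ ((n : ℝ) - 1)⁻¹ := by
  have : (2 : ℝ) ≤ n := by exact_mod_cast hn
  rw [moveWeight]
  split_ifs
  exacts [inv_nonneg.2 (by linarith), le_rfl]

theorem sum_moveWeight {n : ℕ} (hn : 2 ≤ n) (a : Fin n) : ∑ b, moveWeight n a b = 1 := by
  have : (2 : ℝ) ≤ n := by exact_mod_cast hn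
  have h : ((n : ℝ) - 1) ≠ 0 := by linarith
  simp only [moveWeight]
  rw [← sum_erase_add _ _ (mem_univ a), if_pos rfl, add_zero,
    sum_congr rfl fun b hb => if_neg (ne_of_mem_erase hb), sum_const,
    card_erase_of_mem (mem_univ a)]
  simp [Nat.cast_sub (show 1 ≤ n by omega), h]

theorem moveWeight_comm {n : ℕ} (a b : Fin n) : moveWeight n a b = moveWeight n b a := by
  simp only [moveWeight, eq_comm]

theorem sum_moveWeight_left {n : ℕ} (hn : 2 ≤ n) (b : Fin n) : ∑ a, moveWeight n a b = 1 := by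
  simpa only [moveWeight_comm _ b] using sum_moveWeight hn b

/-- The probability that a single agent follows the trajectory `y`. -/
noncomputable def pathWeight (n T : ℕ) (y : Fin (T + 1) → Fin n) : ℝ :=
  (n : ℝ)⁻¹ * ∏ t : Fin T, moveWeight n (y t.castSucc) (y t.succ)

theorem pathWeight_nonneg {n : ℕ} (hn : 2 ≤ n) (T : ℕ) (y : Fin (T + 1) → Fin n) :
    0 ≤ pathWeight n T y :=
  mul_nonneg (by positivity) (prod_nonneg fun _ _ => moveWeight_nonneg hn _ _)

theorem sum_pathWeight_one_mul {n : ℕ} (f : Fin n → Fin n → ℝ) :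
    ∑ y, pathWeight n 1 y * f (y 0) (y 1) = ∑ a, ∑ b, (n : ℝ)⁻¹ * moveWeight n a b * f a b := by
  rw [← (finTwoArrowEquiv (Fin n)).symm.sum_comp, Fintype.sum_prod_type]
  simp only [finTwoArrowEquiv_symm_apply, pathWeight, Fin.prod_univ_one]
  rfl

theorem sum_pathWeight_two_mul {n : ℕ} (f : Fin n → Fin n → Fin n → ℝ) :
    ∑ y, pathWeight n 2 y * f (y 0) (y 1) (y 2) =
      ∑ a, ∑ b, ∑ c, (n : ℝ)⁻¹ * (moveWeight n a b * moveWeight n b c) * f a b c := by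
  rw [← (Fin.consEquiv (fun _ : Fin 3 => Fin n)).sum_comp, Fintype.sum_prod_type]
  refine sum_congr rfl fun a _ => ?_
  rw [← (finTwoArrowEquiv (Fin n)).symm.sum_comp, Fintype.sum_prod_type]
  simp only [finTwoArrowEquiv_symm_apply, pathWeight, Fin.prod_univ_two]
  rfl

theorem sum_pathWeight_one {n : ℕ} (hn : 2 ≤ n) : ∑ y, pathWeight n 1 y = 1 := by
  have := sum_pathWeight_one_mul (n := n) fun _ _ => 1
  simp only [mul_one] at this
  rw [this]
  simp only [← mul_sum, sum_moveWeight hn]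
  simp [show n ≠ 0 by omega]

theorem sum_pathWeight_two {n : ℕ} (hn : 2 ≤ n) : ∑ y, pathWeight n 2 y = 1 := by
  have := sum_pathWeight_two_mul (n := n) fun _ _ _ => 1
  simp only [mul_one] at this
  rw [this]
  simp only [← mul_sum, sum_moveWeight hn, mul_one]
  simp [show n ≠ 0 by omega]

theorem le_sum_pathWeight_arrive {n : ℕ} (hn : 2 ≤ n) (j : Fin n) :
    (n : ℝ)⁻¹ ≤ ∑ y, if y 0 ≠ j ∧ y 1 = j then pathWeight n 1 y else 0 := by
  have := sum_pathWeight_one_mul (n := n) fun a b => if a ≠ j ∧ b = j then 1 else 0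
  simp only [mul_ite, mul_one, mul_zero] at this
  rw [this]
  have h : ∀ a, (∑ b, if a ≠ j ∧ b = j then (n : ℝ)⁻¹ * moveWeight n a b else 0) =
      (n : ℝ)⁻¹ * moveWeight n a j := by
    intro a
    by_cases ha : a = j
    · simp [ha, moveWeight]
    · simp [ha]
  simp only [h, ← mul_sum, sum_moveWeight_left hn, mul_one, le_refl]

theorem le_sum_pathWeight_leave {n : ℕ} (hn : 2 ≤ n) (v : Fin n) (S : Finset (Fin n)) :
    (n : ℝ)⁻¹ * (1 - S.card * ((n : ℝ) - 1)⁻¹) ≤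
      ∑ y, if y 0 = v ∧ y 1 ∉ S then pathWeight n 2 y else 0 := by
  have := sum_pathWeight_two_mul (n := n) fun a b _ => if a = v ∧ b ∉ S then 1 else 0
  simp only [mul_ite, mul_one, mul_zero] at this
  rw [this, sum_eq_single v (by simp +contextual) (by simp)]
  have h : ∀ b, (∑ c, if v = v ∧ b ∉ S then
      (n : ℝ)⁻¹ * (moveWeight n v b * moveWeight n b c) else 0) =
      (n : ℝ)⁻¹ * if b ∈ S then 0 else moveWeight n v b := by
    intro b
    by_cases hb : b ∈ S
    · simp [hb]
    · simp [hb, ← mul_sum, sum_moveWeight hn]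
  rw [sum_congr rfl fun b _ => h b, ← mul_sum]
  refine mul_le_mul_of_nonneg_left ?_ (by positivity)
  have h1 := sum_add_sum_compl S (moveWeight n v)
  rw [sum_moveWeight hn] at h1
  have h2 : ∑ b ∈ S, moveWeight n v b ≤ S.card * ((n : ℝ) - 1)⁻¹ := by
    rw [← nsmul_eq_mul]
    exact sum_le_card_nsmul _ _ _ fun b _ => moveWeight_le hn v b
  have h3 : (∑ b, if b ∈ S then 0 else moveWeight n v b) = ∑ b ∈ Sᶜ, moveWeight n v b := by
    rw [← sum_add_sum_compl S, sum_eq_zero fun b hb => if_pos hb, zero_add]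
    exact sum_congr rfl fun b hb => if_neg (mem_compl.1 hb)
  linarith

theorem le_sum_pathWeight_through {n : ℕ} (hn : 2 ≤ n) (S : Finset (Fin n)) (u : Fin n) :
    (n : ℝ)⁻¹ * ((S.card - 1) * ((n : ℝ) - 1)⁻¹) ≤
      ∑ y, if y 1 ∈ S ∧ y 2 = u then pathWeight n 2 y else 0 := by
  have hn2 : (2 : ℝ) ≤ n := by exact_mod_cast hn
  have := sum_pathWeight_two_mul (n := n) fun _ b c => if b ∈ S ∧ c = u then 1 else 0
  simp only [mul_ite, mul_one, mul_zero] at this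
  rw [this, sum_comm]
  have h : ∀ b, (∑ a, ∑ c, if b ∈ S ∧ c = u then
      (n : ℝ)⁻¹ * (moveWeight n a b * moveWeight n b c) else 0) =
      (n : ℝ)⁻¹ * if b ∈ S then moveWeight n b u else 0 := by
    intro b
    by_cases hb : b ∈ S
    · simp [hb, ← mul_sum, ← sum_mul, sum_moveWeight_left hn]
    · simp [hb]
  simp only [h, ← mul_sum]
  refine mul_le_mul_of_nonneg_left ?_ (by positivity)
  rw [← sum_filter, filter_mem_eq_inter, univ_inter]
  calc _ ≤ ((S.erase u).card : ℝ) * ((n : ℝ) - 1)⁻¹ := by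
        refine mul_le_mul_of_nonneg_right ?_ (inv_nonneg.2 (by linarith))
        have := pred_card_le_card_erase (s := S) (a := u)
        have : S.card ≤ (S.erase u).card + 1 := by omega
        have : (S.card : ℝ) ≤ (S.erase u).card + 1 := by exact_mod_cast this
        linarith
    _ = ∑ b ∈ S.erase u, moveWeight n b u := by
        rw [← nsmul_eq_mul, ← sum_const]
        exact sum_congr rfl fun b hb => (if_neg (ne_of_mem_erase hb).symm).symm
    _ ≤ _ := sum_le_sum_of_subset_of_nonneg (erase_subset _ _)
        fun b _ _ => moveWeight_nonneg hn _ _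

theorem probXiLe_eq_productMass (n k T : ℕ) :
    probXiLe n k T = productMass (pathWeight n T) fun q : Fin k → Fin (T + 1) → Fin n =>
      greenSet n k (fun t a => q a ⟨min t T, Nat.lt_succ_of_le (min_le_right t T)⟩) T = univ := by
  rw [probXiLe, productMass, ← (Equiv.piComm fun (_ : Fin (T + 1)) (_ : Fin k) => Fin n).sum_comp]
  refine sum_congr rfl fun q _ => ?_
  simp only [prefixProb, pathWeight, moveWeight, Equiv.piComm_apply, Function.swap]

theorem notMem_greenSet_one {n k : ℕ} {p : ℕ → Fin k → Fin n} (hk : 0 < k)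
    (hp : ∀ a, p 1 a ≠ p 0 a) {a : Fin k} (h0 : p 0 a ≠ p 0 ⟨0, hk⟩)
    (h1 : p 1 a = p 0 ⟨0, hk⟩) : a ∉ greenSet n k p 1 := by
  have e : ∀ b : Fin k, (b : ℕ) = 0 ↔ b = ⟨0, hk⟩ := fun b => by simp [Fin.ext_iff]
  simp only [greenSet, e, exists_eq_left, mem_union, mem_filter, mem_univ, true_and, not_or,
    not_exists, not_and]
  exact ⟨h0, fun b hb hab => hp b (by rw [hb, ← hab, h1])⟩

theorem mem_greenSet_one {n k : ℕ} {p : ℕ → Fin k → Fin n} (hk : 0 < k) {a b : Fin k}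
    (h0 : p 0 a = p 0 ⟨0, hk⟩) (h1 : p 1 b = p 1 a) : b ∈ greenSet n k p 1 := by
  simp only [greenSet, mem_union, mem_filter, mem_univ, true_and]
  exact Or.inr ⟨a, ⟨⟨0, hk⟩, rfl, h0⟩, h1⟩

theorem greenSet_two_eq_univ {n k : ℕ} {p : ℕ → Fin k → Fin n}
    (h : ∀ u, ∃ b ∈ greenSet n k p 1, p 2 b = u) : greenSet n k p 2 = univ := by
  refine eq_univ_of_forall fun a => ?_
  obtain ⟨b, hb, hab⟩ := h (p 2 a)
  rw [greenSet]
  exact mem_union_right _ (mem_filter.2 ⟨mem_univ _, b, hb, hab.symm⟩)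

theorem probXiLe_one_le {n k : ℕ} (hn : 2 ≤ n) (hk : 0 < k) :
    probXiLe n k 1 ≤ n * Real.exp (-((n : ℝ)⁻¹ * k)) := by
  rw [probXiLe_eq_productMass]
  have hb := productMass_exists_forall_not_le (ι := Fin k) (pathWeight_nonneg hn 1)
    (sum_pathWeight_one hn) univ (fun j y => y 0 ≠ j ∧ y 1 = j) _
    fun j _ => le_sum_pathWeight_arrive hn j
  simp only [card_univ, Fintype.card_fin] at hb
  refine le_trans (productMass_mono (pathWeight_nonneg hn 1) fun q hq hD => ?_) hb
  refine ⟨q ⟨0, hk⟩ 0, mem_univ _, fun a ha => ?_⟩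
  have hmove : ∀ a, q a 1 ≠ q a 0 := fun a h => hq a (by simp [pathWeight, moveWeight, h])
  refine notMem_greenSet_one (n := n) hk
    (p := fun t a => q a ⟨min t 1, Nat.lt_succ_of_le (min_le_right t 1)⟩) hmove ha.1 ha.2 ?_
  rw [hD]
  exact mem_univ a

theorem one_sub_probXiLe_two_le {n k m h : ℕ} (hn : 2 ≤ n) (hm : m ≤ n) (h0 : 0 < h)
    (hk : h ≤ k) :
    1 - probXiLe n k 2 ≤
      n * n ^ m * Real.exp (-((n : ℝ)⁻¹ * (1 - m * ((n : ℝ) - 1)⁻¹) * h)) +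
      n * Real.exp (-((n : ℝ)⁻¹ * ((m - 1) * ((n : ℝ) - 1)⁻¹) * (k - h))) := by
  have hk0 : 0 < k := h0.trans_le hk
  have hn2 : (2 : ℝ) ≤ n := by exact_mod_cast hn
  have hw := pathWeight_nonneg hn 2
  have h1 := sum_pathWeight_two hn
  have hnot := productMass_add_not (ι := Fin k) h1 fun q =>
    greenSet n k (fun t a => q a ⟨min t 2, Nat.lt_succ_of_le (min_le_right t 2)⟩) 2 = univ
  rw [probXiLe_eq_productMass, sub_eq_of_eq_add' hnot.symm]
  have cardA : Fintype.card {a : Fin k // (a : ℕ) < h} = h := by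
    rw [Fintype.card_subtype, Fin.card_filter_val_lt, min_eq_right hk]
  have cardB : Fintype.card {a : Fin k // ¬ (a : ℕ) < h} = k - h := by
    rw [Fintype.card_subtype_compl, cardA, Fintype.card_fin]
  let o : {a : Fin k // (a : ℕ) < h} := ⟨⟨0, hk0⟩, h0⟩
  let S : ({a : Fin k // (a : ℕ) < h} → Fin 3 → Fin n) → Finset (Fin n) := fun α =>
    (univ.filter fun a => α a 0 = α o 0).image fun a => α a 1
  refine productMass_le_add hw h1 (fun a : Fin k => (a : ℕ) < h) _
    (fun α => ∃ j ∈ (univ : Finset (Fin n)) ×ˢ powersetCard m univ,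
      ∀ a, ¬ (α a 0 = j.1 ∧ α a 1 ∉ j.2))
    (fun α β => m ≤ (S α).card ∧ ∃ u ∈ univ, ∀ b, ¬ (β b 1 ∈ S α ∧ β b 2 = u)) ?_ ?_ ?_
  · have hb := productMass_exists_forall_not_le (ι := {a : Fin k // (a : ℕ) < h}) hw h1
      ((univ : Finset (Fin n)) ×ˢ powersetCard m univ)
      (fun j y => y 0 = j.1 ∧ y 1 ∉ j.2) ((n : ℝ)⁻¹ * (1 - m * ((n : ℝ) - 1)⁻¹))
      (fun j hj => by
        have := le_sum_pathWeight_leave hn j.1 j.2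
        rwa [(mem_powersetCard.1 (mem_product.1 hj).2).2] at this)
    rw [cardA] at hb
    refine hb.trans (mul_le_mul_of_nonneg_right ?_ (Real.exp_nonneg _))
    rw [card_product, card_powersetCard, card_univ, Fintype.card_fin]
    exact_mod_cast Nat.mul_le_mul_left _ (Nat.choose_le_pow n m)
  · intro α
    by_cases hS : m ≤ (S α).card
    · have hb := productMass_exists_forall_not_le (ι := {a : Fin k // ¬ (a : ℕ) < h}) hw h1
        univ (fun u y => y 1 ∈ S α ∧ y 2 = u) ((n : ℝ)⁻¹ * ((m - 1) * ((n : ℝ) - 1)⁻¹))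
        (fun u _ => by
          refine le_trans ?_ (le_sum_pathWeight_through hn (S α) u)
          have : (m : ℝ) ≤ (S α).card := by exact_mod_cast hS
          have : 0 ≤ ((n : ℝ) - 1)⁻¹ := inv_nonneg.2 (by linarith)
          gcongr)
      rw [cardB, Nat.cast_sub hk, card_univ, Fintype.card_fin] at hb
      simpa only [hS, true_and] using hb
    · simp only [hS, false_and, productMass, if_false, sum_const_zero]
      positivity
  · intro q hq
    by_cases hS : m ≤ (S fun i => q i).card
    · refine Or.inr ⟨hS, ?_⟩
      by_contra! hc
      refine hq (greenSet_two_eq_univ fun u => ?_)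
      obtain ⟨b, hb, hbu⟩ := hc u (mem_univ _)
      obtain ⟨a, ha, hab⟩ := mem_image.1 hb
      exact ⟨b, mem_greenSet_one hk0 (a := a) (mem_filter.1 ha).2 hab.symm, hbu⟩
    · obtain ⟨T, hST, hT⟩ := exists_superset_card_eq (not_le.1 hS).le (by simpa using hm)
      refine Or.inl ⟨(q ⟨0, hk0⟩ 0, T), ?_, ?_⟩
      · simp [hT]
      · rintro a ⟨ha, ha'⟩
        exact ha' (hST (mem_image.2 ⟨a, mem_filter.2 ⟨mem_univ _, ha⟩, rfl⟩))

theorem probXiMem_two (n k : ℕ) : probXiMem n k {2} = probXiLe n k 2 - probXiLe n k 1 := by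
  rw [probXiMem, tsum_eq_single 2 (by simp +contextual)]
  simp [probXiEq]

theorem probXiLe_nonneg {n : ℕ} (hn : 2 ≤ n) (k T : ℕ) : 0 ≤ probXiLe n k T := by
  rw [probXiLe_eq_productMass]
  exact productMass_nonneg (pathWeight_nonneg hn T) _

theorem probXiLe_two_le_one {n : ℕ} (hn : 2 ≤ n) (k : ℕ) : probXiLe n k 2 ≤ 1 := by
  rw [probXiLe_eq_productMass, ← productMass_add_not (ι := Fin k) (sum_pathWeight_two hn)]
  exact le_add_of_nonneg_right (productMass_nonneg (pathWeight_nonneg hn 2) _)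

/-- Quantitative form of the theorem, under explicit largeness conditions on `n`. -/
theorem probXiMem_two_bounds {n k : ℕ} {y z : ℝ} (hy : 0 < y) (hyz : y < z) (hn : 2 ≤ n)
    (hk : (n : ℝ) ^ (1 + z) ≤ k) (h3 : 3 ≤ (n : ℝ) ^ y) (h4 : 4 ≤ (n : ℝ) ^ (1 - y))
    (hL1 : 12 * Real.log n ≤ (n : ℝ) ^ (z - y))
    (hL2 : 8 * Real.log n ≤ (n : ℝ) ^ (y + z - 1)) :
    1 - 3 * (n : ℝ)⁻¹ ≤ probXiMem n k {2} ∧ probXiMem n k {2} ≤ 1 := by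
  have hN : (2 : ℝ) ≤ n := by exact_mod_cast hn
  have hN0 : (0 : ℝ) < n := by linarith
  set N := (n : ℝ) with hNdef
  set L := Real.log N with hLdef
  set M := N ^ y with hM
  set Z := N ^ z with hZ
  have hL : 0 < L := Real.log_pos (by linarith)
  have hexpL : Real.exp L = N := Real.exp_log hN0
  have hM0 : 0 < M := by linarith
  have hZ0 : 0 < Z := by positivity
  have eZ : M * N ^ (z - y) = Z := by rw [hM, ← Real.rpow_add hN0]; congr 1; ring
  have eN : M * N ^ (1 - y) = N := by
    rw [hM, ← Real.rpow_add hN0, add_sub_cancel, Real.rpow_one]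
  have eW : N * N ^ (y + z - 1) = M * Z := by
    rw [hM, hZ, ← Real.rpow_add hN0, mul_comm, ← Real.rpow_add_one hN0.ne']; congr 1; ring
  have ek : N * Z ≤ k := by rwa [Real.rpow_add hN0, Real.rpow_one] at hk
  have hML : 12 * (M * L) ≤ Z := by nlinarith
  have hNM : 4 * M ≤ N := by nlinarith
  have hWL : 8 * L * N ≤ M * Z := by nlinarith
  have hZ2 : 36 * L ≤ Z := by nlinarith
  have hZ1 : 1 ≤ Z := Real.one_le_rpow (by linarith) (by linarith)
  have hk3 : (3 : ℝ) ≤ k := by nlinarith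
  have hkN : Z ≤ N⁻¹ * k := by rw [inv_mul_eq_div, le_div_iff₀ hN0]; linarith
  set m := ⌈M⌉₊ with hm
  have hm1 : M ≤ m := Nat.le_ceil M
  have hm2 : (m : ℝ) < M + 1 := Nat.ceil_lt_add_one hM0.le
  have hmn : m ≤ n := by
    have : (m : ℝ) ≤ n := by rw [← hNdef]; linarith
    exact_mod_cast this
  have hk3' : 3 ≤ k := by exact_mod_cast hk3
  have hh1 : (k : ℝ) ≤ 3 * (k / 2 : ℕ) := by exact_mod_cast (by omega : k ≤ 3 * (k / 2))
  have hh2 : 2 * ((k / 2 : ℕ) : ℝ) ≤ k := by exact_mod_cast (by omega : 2 * (k / 2) ≤ k)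
  have b1 := probXiLe_one_le (k := k) hn (by omega)
  have b2 := one_sub_probXiLe_two_le (k := k) hn hmn (h := k / 2) (by omega) (by omega)
  rw [← hNdef] at b1 b2
  generalize ((k / 2 : ℕ) : ℝ) = h at *
  have hexp : ∀ s, s ≤ -L → Real.exp s ≤ N⁻¹ := fun s hs => by
    rw [← hexpL, ← Real.exp_neg]; exact Real.exp_le_exp.2 hs
  have c1 : N * Real.exp (-(N⁻¹ * k)) ≤ N⁻¹ := by
    nth_rewrite 1 [← hexpL]
    rw [← Real.exp_add]
    exact hexp _ (by linarith)
  have c2 : N * N ^ m * Real.exp (-(N⁻¹ * (1 - m * (N - 1)⁻¹) * h)) ≤ N⁻¹ := by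
    have e : N * N ^ m = Real.exp ((m + 1) * L) := by
      rw [add_mul, one_mul, Real.exp_add, Real.exp_nat_mul, hexpL]; ring
    rw [e, ← Real.exp_add]
    refine hexp _ ?_
    have q1 : 1 / 2 ≤ 1 - m * (N - 1)⁻¹ := by
      have : m * (N - 1)⁻¹ ≤ 1 / 2 := by
        rw [← div_eq_mul_inv, div_le_iff₀ (by linarith)]; linarith
      linarith
    have q2 : Z / 3 ≤ N⁻¹ * h := by
      have : N⁻¹ * k ≤ N⁻¹ * (3 * h) := mul_le_mul_of_nonneg_left hh1 (by positivity)
      linarith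
    have q3 : Z / 3 * (1 / 2) ≤ N⁻¹ * h * (1 - m * (N - 1)⁻¹) :=
      mul_le_mul q2 q1 (by norm_num) ((by positivity : 0 ≤ Z / 3).trans q2)
    have q4 : (m : ℝ) * L ≤ (M + 1) * L := mul_le_mul_of_nonneg_right hm2.le hL.le
    have q5 : N⁻¹ * h * (1 - m * (N - 1)⁻¹) = N⁻¹ * (1 - m * (N - 1)⁻¹) * h := by ring
    linarith
  have c3 : N * Real.exp (-(N⁻¹ * ((m - 1) * (N - 1)⁻¹) * (k - h))) ≤ N⁻¹ := by
    nth_rewrite 1 [← hexpL]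
    rw [← Real.exp_add]
    refine hexp _ ?_
    have q1 : M / 2 * N⁻¹ ≤ (m - 1) * (N - 1)⁻¹ :=
      mul_le_mul (by linarith) (inv_anti₀ (by linarith) (by linarith)) (by positivity)
        (by linarith)
    have q2 : Z / 2 ≤ N⁻¹ * (k - h) := by
      have : N⁻¹ * k ≤ N⁻¹ * (2 * (k - h)) :=
        mul_le_mul_of_nonneg_left (by linarith) (by positivity)
      linarith
    have q3 : Z / 2 * (M / 2 * N⁻¹) ≤ N⁻¹ * (k - h) * ((m - 1) * (N - 1)⁻¹) :=
      mul_le_mul q2 q1 (by positivity) ((by positivity : 0 ≤ Z / 2).trans q2)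
    have q4 : 8 * L ≤ M * Z * N⁻¹ := by
      rw [← div_eq_mul_inv, le_div_iff₀ hN0]; exact hWL
    have q5 : N⁻¹ * (k - h) * ((m - 1) * (N - 1)⁻¹) =
      N⁻¹ * ((m - 1) * (N - 1)⁻¹) * (k - h) := by ring
    have q6 : Z / 2 * (M / 2 * N⁻¹) = M * Z * N⁻¹ / 4 := by ring
    linarith
  rw [probXiMem_two]
  have := probXiLe_nonneg hn k 1
  have := probXiLe_two_le_one hn k
  constructor <;> linarith

theorem eventually_mul_log_le_rpow {c s : ℝ} (hc : 0 < c) (hs : 0 < s) :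
    ∀ᶠ n : ℕ in atTop, c * Real.log n ≤ (n : ℝ) ^ s := by
  have := ((isLittleO_log_rpow_atTop hs).bound (inv_pos.2 hc)).and (eventually_ge_atTop 1)
  filter_upwards [tendsto_natCast_atTop_atTop.eventually this] with n ⟨hn, hn1⟩
  rw [Real.norm_of_nonneg (Real.log_nonneg hn1), Real.norm_of_nonneg (by positivity),
    le_inv_mul_iff₀ hc] at hn
  exact hn

theorem eventually_le_natCast_rpow (c : ℝ) {s : ℝ} (hs : 0 < s) :
    ∀ᶠ n : ℕ in atTop, c ≤ (n : ℝ) ^ s :=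
  ((tendsto_rpow_atTop hs).comp tendsto_natCast_atTop_atTop).eventually_ge_atTop c

theorem eventually_rpow_le_of_tendsto_log_div_log {k : ℕ → ℕ} {c d : ℝ} (hd : 0 ≤ d) (hdc : d < c)
    (hk : Tendsto (fun n => Real.log (k n) / Real.log n) atTop (nhds c)) :
    ∀ᶠ n : ℕ in atTop, (n : ℝ) ^ d ≤ k n := by
  filter_upwards [hk.eventually (eventually_gt_nhds hdc), eventually_ge_atTop 2] with n h hn
  have hN : (2 : ℝ) ≤ n := by exact_mod_cast hn
  have hL : 0 < Real.log n := Real.log_pos (by linarith)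
  rw [lt_div_iff₀ hL] at h
  have hk0 : (0 : ℝ) < k n := by
    refine Nat.cast_pos.2 (Nat.pos_of_ne_zero fun h0 => ?_)
    rw [h0, Nat.cast_zero, Real.log_zero] at h
    exact absurd h (not_lt.2 (by positivity))
  rw [Real.rpow_def_of_pos (by linarith), ← Real.exp_log hk0, mul_comm]
  exact Real.exp_le_exp.2 h.le

/-- **Theorem 1.1(f).**  Fix a real `x > 1/2` and suppose `k = k(n) = n^{1+x+o(1)}`, i.e.
`ln k(n)/ln n → 1 + x`.  Then a.a.s. `ξ(K_n, k) = 2`. -/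
theorem broadcasting_time_very_large_k
    (x : ℝ) (hx : 1 / 2 < x)
    (k : ℕ → ℕ)
    (hk : Tendsto (fun n => Real.log (k n) / Real.log n) atTop (nhds (1 + x))) :
    Tendsto (fun n => probXiMem n (k n) {2}) atTop (nhds 1) := by
  obtain ⟨y, hy, hy'⟩ := exists_between (lt_min hx (by norm_num : (1 / 2 : ℝ) < 1))
  obtain ⟨hyx, hy1⟩ := lt_min_iff.1 hy'
  obtain ⟨z, hyz, hzx⟩ := exists_between hyx
  have hbounds : ∀ᶠ n : ℕ in atTop,
      1 - 3 * (n : ℝ)⁻¹ ≤ probXiMem n (k n) {2} ∧ probXiMem n (k n) {2} ≤ 1 := by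
    filter_upwards [eventually_ge_atTop 2,
      eventually_rpow_le_of_tendsto_log_div_log (by linarith)
        (by linarith : 1 + z < 1 + x) hk,
      eventually_le_natCast_rpow 3 (by linarith : 0 < y),
      eventually_le_natCast_rpow 4 (by linarith : 0 < 1 - y),
      eventually_mul_log_le_rpow (c := 12) (by norm_num) (by linarith : 0 < z - y),
      eventually_mul_log_le_rpow (c := 8) (by norm_num) (by linarith : 0 < y + z - 1)]
      with n hn hkn h3 h4 hL1 hL2
    exact probXiMem_two_bounds (by linarith) hyz hn hkn h3 h4 hL1 hL2
  have hlim : Tendsto (fun n : ℕ => 1 - 3 * (n : ℝ)⁻¹) atTop (nhds 1) := by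
    simpa using (tendsto_inv_atTop_nhds_zero_nat (𝕜 := ℝ)).const_mul 3 |>.const_sub 1
  exact tendsto_of_tendsto_of_tendsto_of_le_of_le' hlim tendsto_const_nhds
    (hbounds.mono fun _ h => h.1) (hbounds.mono fun _ h => h.2)
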